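/- Let H be a simple 3-connected graph, G a 2-connected graph with a 2-separation (A,B) with A ∩ B = {u,v}, let X = {a,b,c,d} ⊆ V(G) be four distinct vertices, and let 𝓕 be a family of injective maps from X to V(H). Suppose u = a, exactly one vertex x of X lies in A \ {u,v}, and the two remaining vertices of X lie in B \ {u,v}. Let X_A = {u,v} ∪ (X ∩ (B \ {u,v})) and, for each π ∈ 𝓕, define π_A : X_A → V(H) by π_A = π on X_A \ {v} and π_A(v) = π(x); let 𝓕_A be the resulting family. Then G has an H(X)-minor if and only if the graph G_B = G[B] plus the edge uv has an H(X_A)-minor (with respect to 𝓕_A). -/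

import Mathlib

namespace Paper

open SimpleGraph

variable {V : Type*} {U : Type*}

/-- An `H`-model in `G`: pairwise vertex-disjoint connected branch sets indexed by the
vertices of `H`, with an edge of `G` between the branch sets of any two vertices
adjacent in `H`. -/
structure IsModel (G : SimpleGraph V) {W : Type*} (H : SimpleGraph W) (B : W → Set V) :
    Prop where
  connected : ∀ x : W, (G.induce (B x)).Connected
  disjoint : ∀ x y : W, x ≠ y → Disjoint (B x) (B y)
  adj_of_adj : ∀ ⦃x y : W⦄, H.Adj x y → ∃ u ∈ B x, ∃ v ∈ B y, G.Adj u v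

/-- `G` is `k`-connected: it has more than `k` vertices, and deleting any set of fewer
than `k` vertices leaves a connected graph. -/
def KConnected (G : SimpleGraph V) [Fintype V] (k : ℕ) : Prop :=
  k < Fintype.card V ∧ ∀ S : Set V, S.ncard < k → (G.induce Sᶜ).Connected

/-- A separation of `G`: a pair of vertex sets covering `V(G)` with no edge of `G`
between `A \ B` and `B \ A`. -/
def IsSeparation (G : SimpleGraph V) (A B : Set V) : Prop :=
  A ∪ B = Set.univ ∧ ∀ u v : V, u ∈ A \ B → v ∈ B \ A → ¬ G.Adj u v

/-- `G` has a rooted `H(X)`-minor for `X = {r 0, r 1, r 2, r 3}` with respect to the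
family `F`: here a map `π : X → V(H)` is represented by the tuple of the images of
`r 0, r 1, r 2, r 3` in this order.  So an `H(X)`-minor is an `H`-model of `G` together
with some `π ∈ F` such that each root `r i` lies in the branch set of `π i`. -/
def HasRootedMinor (G : SimpleGraph V) {W : Type*} (H : SimpleGraph W) (r : Fin 4 → V)
    (F : Set (Fin 4 → W)) : Prop :=
  ∃ (B : W → Set V) (π : Fin 4 → W), π ∈ F ∧ IsModel G H B ∧ ∀ i, r i ∈ B (π i)

theorem connected_of_surjective_of_reachable {V V' : Type*} {G : SimpleGraph V}
    {G' : SimpleGraph V'} (hG : G.Connected) (f : V → V') (hf : Function.Surjective f)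
    (hadj : ∀ p q, G.Adj p q → G'.Reachable (f p) (f q)) : G'.Connected := by
  have hreach : ∀ p q, G.Reachable p q → G'.Reachable (f p) (f q) := by
    rintro p q ⟨walk⟩
    induction walk with
    | nil => exact Reachable.refl _
    | cons h _ ih => exact (hadj _ _ h).trans ih
  have : Nonempty V' := hG.nonempty.map f
  refine ⟨fun p q => ?_⟩
  obtain ⟨p, rfl⟩ := hf p
  obtain ⟨q, rfl⟩ := hf q
  exact hreach p q (hG.preconnected p q)

theorem exists_adj_boundary {V : Type*} {G : SimpleGraph V} {S T : Set V}
    (hS : (G.induce S).Connected) {p q : V} (hp : p ∈ S) (hpT : p ∈ T) (hq : q ∈ S)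
    (hqT : q ∉ T) : ∃ s ∈ S, ∃ t ∈ S, s ∈ T ∧ t ∉ T ∧ G.Adj s t := by
  obtain ⟨walk⟩ := hS.preconnected ⟨p, hp⟩ ⟨q, hq⟩
  obtain ⟨e, -, h1, h2⟩ := walk.exists_boundary_dart (Subtype.val ⁻¹' T) hpT hqT
  exact ⟨e.fst, e.fst.2, e.snd, e.snd.2, h1, h2, e.adj⟩

/-- If all edges leaving `T` inside a connected set `S` start at a single vertex `p`, then
`S ∩ T` is connected. -/
theorem connected_induce_inter {V : Type*} {G : SimpleGraph V} {S T : Set V}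
    (hS : (G.induce S).Connected) {p : V} (hp : p ∈ S ∩ T)
    (hleave : ∀ t ∈ S, ∀ s ∈ S, t ∈ T → s ∉ T → G.Adj t s → t = p) :
    (G.induce (S ∩ T)).Connected := by
  classical
  refine connected_of_surjective_of_reachable hS
    (fun s => if h : s.1 ∈ T then ⟨s.1, s.2, h⟩ else ⟨p, hp⟩) ?_ ?_
  · rintro ⟨s, hs, hsT⟩
    exact ⟨⟨s, hs⟩, by simp [hsT]⟩
  · rintro ⟨s, hs⟩ ⟨t, ht⟩ hst
    have hst : G.Adj s t := hst
    by_cases hsT : s ∈ T <;> by_cases htT : t ∈ T <;> simp only [hsT, htT, dite_true, dite_false]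
    · exact Adj.reachable (G := G.induce (S ∩ T)) hst
    · obtain rfl := hleave s hs t ht hsT htT hst
      exact Reachable.refl _
    · obtain rfl := hleave t ht s hs htT hsT hst.symm
      exact Reachable.refl _
    · exact Reachable.refl _

section TwoSeparation

variable {V : Type*} {G : SimpleGraph V} {A B : Set V} {u v : V}

theorem IsSeparation.mem_cut_of_adj (hsep : IsSeparation G A B) (hAB : A ∩ B = {u, v})
    {s t : V} (hs : s ∈ B) (ht : t ∉ B) (hst : G.Adj s t) : s = u ∨ s = v := by
  have htA : t ∈ A := (hsep.1.symm ▸ Set.mem_univ t : t ∈ A ∪ B).resolve_right ht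
  by_contra hcut
  have hsA : s ∉ A := fun hsA => hcut (by
    have : s ∈ A ∩ B := ⟨hsA, hs⟩
    simpa [hAB] using this)
  exact hsep.2 t s ⟨htA, ht⟩ ⟨hs, hsA⟩ hst.symm

theorem IsSeparation.symm (hsep : IsSeparation G A B) : IsSeparation G B A :=
  ⟨Set.union_comm A B ▸ hsep.1, fun s t hs ht hst => hsep.2 t s ht hs hst.symm⟩

theorem IsSeparation.subset_of_connected (hsep : IsSeparation G A B) (hAB : A ∩ B = {u, v})
    {S : Set V} (hS : (G.induce S).Connected) (hu : u ∉ S) (hv : v ∉ S) {p : V} (hp : p ∈ S)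
    (hpB : p ∈ B) : S ⊆ B := by
  intro q hq
  by_contra hqB
  obtain ⟨s, hs, t, -, hsB, htB, hst⟩ := exists_adj_boundary hS hp hpB hq hqB
  rcases hsep.mem_cut_of_adj hAB hsB htB hst with rfl | rfl
  exacts [hu hs, hv hs]

theorem connected_induce_preimage (hsep : IsSeparation G A B) (hAB : A ∩ B = {u, v})
    {S : Set V} (hS : (G.induce S).Connected) (hnot : ¬ (u ∈ S ∧ v ∈ S)) (hSB : (S ∩ B).Nonempty)
    (E : SimpleGraph B) :
    ((G.induce B ⊔ E).induce (Subtype.val ⁻¹' S : Set B)).Connected := by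
  have huvB : u ∈ B ∧ v ∈ B := by
    have h : ({u, v} : Set V) ⊆ B := hAB ▸ Set.inter_subset_right
    exact ⟨h (by simp), h (by simp)⟩
  have hinter : (G.induce (S ∩ B)).Connected := by
    obtain ⟨p, hp, hleave⟩ : ∃ p ∈ S ∩ B, ∀ t ∈ S, t = u ∨ t = v → t = p := by
      obtain ⟨q, hq⟩ := hSB
      by_cases hu : u ∈ S
      · refine ⟨u, ⟨hu, huvB.1⟩, ?_⟩
        rintro t ht (rfl | rfl)
        · rfl
        · exact (hnot ⟨hu, ht⟩).elim
      · by_cases hv : v ∈ S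
        · refine ⟨v, ⟨hv, huvB.2⟩, ?_⟩
          rintro t ht (rfl | rfl)
          · exact (hu ht).elim
          · rfl
        · refine ⟨q, hq, ?_⟩
          rintro t ht (rfl | rfl)
          exacts [(hu ht).elim, (hv ht).elim]
    exact connected_induce_inter hS hp fun t ht s _ htB hsB hts =>
      hleave t ht (hsep.mem_cut_of_adj hAB htB hsB hts)
  refine connected_of_surjective_of_reachable hinter (fun s => ⟨⟨s.1, s.2.2⟩, s.2.1⟩) ?_ ?_
  · rintro ⟨⟨s, hsB⟩, hs⟩
    exact ⟨⟨s, hs, hsB⟩, rfl⟩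
  · intro s t hst
    exact Adj.reachable (Or.inl hst)

theorem adj_of_adj_sup_edge {huB : u ∈ B} {hvB : v ∈ B} {s t : B}
    (hst : (G.induce B ⊔ fromEdgeSet {s((⟨u, huB⟩ : B), (⟨v, hvB⟩ : B))}).Adj s t) :
    G.Adj s t ∨ (s.1 = u ∧ t.1 = v) ∨ (s.1 = v ∧ t.1 = u) := by
  rcases hst with hst | hst
  · exact Or.inl hst
  · rw [fromEdgeSet_adj, Set.mem_singleton_iff, Sym2.eq_iff] at hst
    right
    rcases hst.1 with ⟨rfl, rfl⟩ | ⟨rfl, rfl⟩ <;> simp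

theorem connected_induce_image {huB : u ∈ B} {hvB : v ∈ B} {T : Set B}
    (hT : ((G.induce B ⊔ fromEdgeSet {s((⟨u, huB⟩ : B), (⟨v, hvB⟩ : B))}).induce T).Connected)
    (hnot : ¬ ((⟨u, huB⟩ : B) ∈ T ∧ (⟨v, hvB⟩ : B) ∈ T)) :
    (G.induce (Subtype.val '' T)).Connected := by
  refine connected_of_surjective_of_reachable hT (fun s => ⟨s.1.1, s.1, s.2, rfl⟩) ?_ ?_
  · rintro ⟨_, s, hs, rfl⟩
    exact ⟨⟨s, hs⟩, rfl⟩
  · rintro ⟨⟨s, hsB⟩, hs⟩ ⟨⟨t, htB⟩, ht⟩ hst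
    rcases adj_of_adj_sup_edge hst with hst | ⟨rfl, rfl⟩ | ⟨rfl, rfl⟩
    · exact Adj.reachable (G := G.induce (Subtype.val '' T)) hst
    · exact (hnot ⟨hs, ht⟩).elim
    · exact (hnot ⟨ht, hs⟩).elim

variable {W : Type*} {H : SimpleGraph W}

/-- All branch sets avoiding the cut lie on the same side of the separation. -/
theorem IsModel.subset_of_avoids_cut [Fintype W] (hH : KConnected H 3)
    (hsep : IsSeparation G A B) (hAB : A ∩ B = {u, v}) {M : W → Set V} (hM : IsModel G H M)
    {wu wv : W} (hu : ∀ w, u ∈ M w → w = wu) (hv : ∀ w, v ∈ M w → w = wv)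
    {k : W} (hku : k ≠ wu) (hkv : k ≠ wv) {p : V} (hp : p ∈ M k) (hpB : p ∈ B) {w : W}
    (hwu : w ≠ wu) (hwv : w ≠ wv) : M w ⊆ B := by
  have hconn : (H.induce ({wu, wv} : Set W)ᶜ).Connected :=
    hH.2 _ ((Set.ncard_insert_le _ _).trans_lt (by simp))
  have hside : ∀ w, w ≠ wu → w ≠ wv → ∀ q ∈ M w, q ∈ B → M w ⊆ B := fun w h1 h2 q hq hqB =>
    hsep.subset_of_connected hAB (hM.connected w) (fun h => h1 (hu w h)) (fun h => h2 (hv w h))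
      hq hqB
  by_contra hwB
  obtain ⟨y, hy, z, hz, hyB, hzB, hyz⟩ := exists_adj_boundary (T := {y | M y ⊆ B}) hconn
    (p := k) (q := w) (by simp [hku, hkv]) (hside k hku hkv p hp hpB) (by simp [hwu, hwv]) hwB
  simp only [Set.mem_compl_iff, Set.mem_insert_iff, Set.mem_singleton_iff, not_or] at hy hz
  obtain ⟨s, hs, t, ht, hst⟩ := hM.adj_of_adj hyz
  by_cases htB : t ∈ B
  · exact hzB (hside z hz.1 hz.2 t ht htB)
  · rcases hsep.mem_cut_of_adj hAB (hyB hs) htB hst with rfl | rfl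
    exacts [hy.1 (hu y hs), hy.2 (hv y hs)]

variable {r : Fin 4 → V} {F : Set (Fin 4 → W)} {j : Fin 4} {huB : u ∈ B} {hvB : v ∈ B}
  {r' : Fin 4 → B}

theorem HasRootedMinor.restrict [Fintype W] (hH : KConnected H 3)
    (hsep : IsSeparation G A B) (hAB : A ∩ B = {u, v}) (huv : u ≠ v)
    (hF : ∀ π ∈ F, Function.Injective π) {i k₁ k₂ : Fin 4} (hij : i ≠ j) (hk : k₁ ≠ k₂)
    (hik₁ : i ≠ k₁) (hik₂ : i ≠ k₂) (hjk₁ : j ≠ k₁) (hjk₂ : j ≠ k₂)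
    (hri : r i = u) (hrj : r j ∉ B) (hrk₁ : r k₁ ∈ B) (hrk₂ : r k₂ ∈ B)
    (hr' : ∀ l, (r' l : V) = if l = j then v else r l) (hmin : HasRootedMinor G H r F) :
    HasRootedMinor (G.induce B ⊔ fromEdgeSet {s((⟨u, huB⟩ : B), (⟨v, hvB⟩ : B))}) H r' F := by
  obtain ⟨M, π, hπ, hM, hr⟩ := hmin
  have hinj := hF π hπ
  have huniq : ∀ {p w w'}, p ∈ M w → p ∈ M w' → w = w' := fun {p w w'} h h' => by
    by_contra hne
    exact Set.disjoint_left.1 (hM.disjoint w w' hne) h h'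
  have hu : u ∈ M (π i) := hri ▸ hr i
  have hnotu : ∀ l, i ≠ l → u ∉ M (π l) := fun l hl h => hl (hinj (huniq hu h))
  obtain ⟨k, hik, hjk, hkv, hrk⟩ : ∃ k, i ≠ k ∧ j ≠ k ∧ v ∉ M (π k) ∧ r k ∈ B := by
    by_cases h : v ∈ M (π k₁)
    · exact ⟨k₂, hik₂, hjk₂, fun h' => hk (hinj (huniq h h')), hrk₂⟩
    · exact ⟨k₁, hik₁, hjk₁, h, hrk₁⟩
  have hv : v ∈ M (π j) := by
    by_contra hvj
    by_cases hex : ∃ w, v ∈ M w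
    · obtain ⟨w, hw⟩ := hex
      refine hrj (hM.subset_of_avoids_cut hH hsep hAB (fun w' h => huniq h hu)
        (fun w' h => huniq h hw) (fun h => hik (hinj h).symm) ?_ (hr k) hrk
        (fun h => hij (hinj h).symm) ?_ (hr j))
      · rintro rfl; exact hkv hw
      · rintro rfl; exact hvj hw
    · exact hrj (hM.subset_of_avoids_cut (wv := π i) hH hsep hAB (fun w' h => huniq h hu)
        (fun w' h => (hex ⟨w', h⟩).elim) (fun h => hik (hinj h).symm)
        (fun h => hik (hinj h).symm) (hr k) hrk
        (fun h => hij (hinj h).symm) (fun h => hij (hinj h).symm) (hr j))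
  have hside : ∀ w, w ≠ π i → w ≠ π j → M w ⊆ B := fun w hwi hwj =>
    hM.subset_of_avoids_cut hH hsep hAB (fun w' h => huniq h hu) (fun w' h => huniq h hv)
      (fun h => hik (hinj h).symm) (fun h => hjk (hinj h).symm) (hr k) hrk hwi hwj
  have hadj : ∀ w w', H.Adj w w' → w ≠ π i → w ≠ π j →
      ∃ s ∈ M w, ∃ t ∈ M w', s ∈ B ∧ t ∈ B ∧ G.Adj s t := by
    intro w w' hww' hwi hwj
    obtain ⟨s, hs, t, ht, hst⟩ := hM.adj_of_adj hww'
    have hsB := hside w hwi hwj hs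
    refine ⟨s, hs, t, ht, hsB, ?_, hst⟩
    by_contra htB
    rcases hsep.mem_cut_of_adj hAB hsB htB hst with rfl | rfl
    exacts [hwi (huniq hs hu), hwj (huniq hs hv)]
  refine ⟨fun w => Subtype.val ⁻¹' M w, π, hπ, ⟨fun w => ?_, fun w w' hne => ?_, ?_⟩, fun l => ?_⟩
  · refine connected_induce_preimage hsep hAB (hM.connected w)
      (fun h => hij (hinj (huniq hu h.1 |>.trans (huniq h.2 hv)))) ?_ _
    by_cases hwi : w = π i
    · exact ⟨u, hwi ▸ hu, huB⟩
    by_cases hwj : w = π j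
    · exact ⟨v, hwj ▸ hv, hvB⟩
    obtain ⟨⟨p, hp⟩⟩ := (hM.connected w).nonempty
    exact ⟨p, hp, hside w hwi hwj hp⟩
  · exact (hM.disjoint w w' hne).preimage _
  · intro w w' hww'
    by_cases hw : w ≠ π i ∧ w ≠ π j
    · obtain ⟨s, hs, t, ht, hsB, htB, hst⟩ := hadj w w' hww' hw.1 hw.2
      exact ⟨⟨s, hsB⟩, hs, ⟨t, htB⟩, ht, Or.inl hst⟩
    by_cases hw' : w' ≠ π i ∧ w' ≠ π j
    · obtain ⟨s, hs, t, ht, hsB, htB, hst⟩ := hadj w' w hww'.symm hw'.1 hw'.2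
      exact ⟨⟨t, htB⟩, ht, ⟨s, hsB⟩, hs, Or.inl hst.symm⟩
    have hedge : (G.induce B ⊔ fromEdgeSet {s((⟨u, huB⟩ : B), (⟨v, hvB⟩ : B))}).Adj
        ⟨u, huB⟩ ⟨v, hvB⟩ := Or.inr (by simp [huv])
    have hne := hww'.ne
    obtain ⟨rfl, rfl⟩ | ⟨rfl, rfl⟩ : (w = π i ∧ w' = π j) ∨ (w = π j ∧ w' = π i) := by grind
    · exact ⟨⟨u, huB⟩, hu, ⟨v, hvB⟩, hv, hedge⟩
    · exact ⟨⟨v, hvB⟩, hv, ⟨u, huB⟩, hu, hedge.symm⟩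
  · change (r' l : V) ∈ M (π l)
    rw [hr' l]
    split_ifs with h
    exacts [h ▸ hv, hr l]

theorem connected_induce_diff_singleton [Fintype V] (hG : KConnected G 2)
    (hsep : IsSeparation G A B) (hAB : A ∩ B = {u, v}) (huv : u ≠ v) :
    (G.induce (A \ {u})).Connected := by
  have hvA : v ∈ A := (hAB.symm ▸ (by simp) : v ∈ A ∩ B).1
  have h := connected_induce_inter (T := A) (p := v) (hG.2 {u} (by simp))
    ⟨by simpa using huv.symm, hvA⟩
    fun t ht s _ htA hsA hts =>
      (hsep.symm.mem_cut_of_adj (Set.inter_comm A B ▸ hAB) htA hsA hts).resolve_left ht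
  rwa [Set.inter_comm, ← Set.sdiff_eq] at h

theorem exists_adj_cut_vertex [Fintype V] (hG : KConnected G 2)
    (hsep : IsSeparation G A B) (hAB : A ∩ B = {u, v}) (huv : u ≠ v) {x : V}
    (hxB : x ∉ B) : ∃ y ∈ A \ {u}, G.Adj y u := by
  have huvB : u ∈ B ∧ v ∈ B := by
    have h : ({u, v} : Set V) ⊆ B := hAB ▸ Set.inter_subset_right
    exact ⟨h (by simp), h (by simp)⟩
  obtain ⟨s, hs, t, ht, hsB, htB, hst⟩ := exists_adj_boundary (T := B) (p := u) (q := x)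
    (hG.2 {v} (by simp)) huv huvB.1 (by rintro rfl; exact hxB huvB.2) hxB
  obtain rfl := (hsep.mem_cut_of_adj hAB hsB htB hst).resolve_right hs
  exact ⟨t, ⟨(hsep.1.symm ▸ Set.mem_univ t : t ∈ A ∪ B).resolve_right htB, hst.ne'⟩, hst.symm⟩

theorem HasRootedMinor.extend [Fintype V] (hG : KConnected G 2)
    (hsep : IsSeparation G A B) (hAB : A ∩ B = {u, v}) (huv : u ≠ v)
    (hF : ∀ π ∈ F, Function.Injective π) {i : Fin 4} (hij : i ≠ j)
    (hri : r i = u) (hrjA : r j ∈ A) (hrj : r j ∉ B)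
    (hr' : ∀ l, (r' l : V) = if l = j then v else r l)
    (hmin : HasRootedMinor
      (G.induce B ⊔ fromEdgeSet {s((⟨u, huB⟩ : B), (⟨v, hvB⟩ : B))}) H r' F) :
    HasRootedMinor G H r F := by
  classical
  obtain ⟨M, π, hπ, hM, hr⟩ := hmin
  have hinj := hF π hπ
  have huniq : ∀ {p w w'}, p ∈ M w → p ∈ M w' → w = w' := fun {p w w'} h h' => by
    by_contra hne
    exact Set.disjoint_left.1 (hM.disjoint w w' hne) h h'
  have hu : (⟨u, huB⟩ : B) ∈ M (π i) := by
    have : r' i = ⟨u, huB⟩ := Subtype.ext (by simp [hr', hij, hri])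
    exact this ▸ hr i
  have hv : (⟨v, hvB⟩ : B) ∈ M (π j) := by
    have : r' j = ⟨v, hvB⟩ := Subtype.ext (by simp [hr'])
    exact this ▸ hr j
  have hvA : v ∈ A \ {u} := ⟨(hAB.symm ▸ (by simp) : v ∈ A ∩ B).1, huv.symm⟩
  have hπij : π i ≠ π j := fun h => hij (hinj h)
  let N : W → Set V := fun w => Subtype.val '' M w ∪ if w = π j then A \ {u} else ∅
  have hsub : ∀ {w} {p : B}, p ∈ M w → p.1 ∈ N w := fun h => Or.inl ⟨_, h, rfl⟩
  have hNj : A \ {u} ⊆ N (π j) := fun p hp => Or.inr (by simpa using hp)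
  have hcases : ∀ {w p}, p ∈ N w → (∃ hp : p ∈ B, (⟨p, hp⟩ : B) ∈ M w) ∨
      (w = π j ∧ p ∈ A \ {u} ∧ p ∉ B) := by
    intro w p hp
    by_cases hpB : p ∈ B
    · left
      refine ⟨hpB, ?_⟩
      rcases hp with ⟨q, hq, rfl⟩ | hp
      · exact hq
      · split_ifs at hp with hw
        · have hcut : p = u ∨ p = v := by
            have : p ∈ A ∩ B := ⟨hp.1, hpB⟩
            simpa [hAB] using this
          obtain rfl := hcut.resolve_left hp.2
          exact hw ▸ hv
        · exact hp.elim
    · right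
      rcases hp with ⟨q, hq, rfl⟩ | hp
      · exact (hpB q.2).elim
      · split_ifs at hp with hw
        · exact ⟨hw, hp, hpB⟩
        · exact hp.elim
  refine ⟨N, π, hπ, ⟨fun w => ?_, fun w w' hne => ?_, ?_⟩, fun l => ?_⟩
  · have hconn : (G.induce (Subtype.val '' M w)).Connected :=
      connected_induce_image (hM.connected w) fun h => hπij ((huniq hu h.1).trans (huniq h.2 hv))
    by_cases hw : w = π j
    · subst hw
      have := induce_union_connected hconn.preconnected
        (connected_induce_diff_singleton hG hsep hAB huv).preconnected
        ⟨v, ⟨_, hv, rfl⟩, hvA⟩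
      change (G.induce (_ ∪ _)).Connected
      rwa [if_pos rfl]
    · change (G.induce (_ ∪ _)).Connected
      rwa [if_neg hw, Set.union_empty]
  · rw [Set.disjoint_left]
    intro p hp hp'
    rcases hcases hp with ⟨h, hp⟩ | ⟨h, -, hpB⟩ <;>
      rcases hcases hp' with ⟨h', hp'⟩ | ⟨h', -, hpB'⟩
    · exact hne (huniq hp hp')
    · exact hpB' h
    · exact hpB h'
    · exact hne (h.trans h'.symm)
  · obtain ⟨y, hy, hyu⟩ := exists_adj_cut_vertex hG hsep hAB huv hrj
    intro w w' hww'
    obtain ⟨⟨s, hsB⟩, hs, ⟨t, htB⟩, ht, hst⟩ := hM.adj_of_adj hww'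
    rcases adj_of_adj_sup_edge hst with hst | ⟨rfl, rfl⟩ | ⟨rfl, rfl⟩
    · exact ⟨s, hsub hs, t, hsub ht, hst⟩
    · obtain rfl := huniq ht hv
      exact ⟨s, hsub hs, y, hNj hy, hyu.symm⟩
    · obtain rfl := huniq hs hv
      exact ⟨y, hNj hy, t, hsub ht, hyu⟩
  · by_cases hl : l = j
    · subst hl
      exact hNj ⟨hrjA, fun h => hrj (h ▸ huB)⟩
    · have : (r' l : V) = r l := by simp [hr', hl]
      exact this ▸ hsub (hr l)

end TwoSeparation

/-- 2-separation `(A,B)` with `A ∩ B = {u,v}`, `u = a`, exactly one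
vertex `x` of `X` in `A \ {u,v}` and the remaining two vertices of `X` in `B \ {u,v}`.
With `X_A = {u,v} ∪ (X ∩ (B \ {u,v}))` and, for each `π ∈ F`, `π_A = π` on
`X_A \ {v}` and `π_A(v) = π(x)` (so that, over the ordered roots obtained from
`(a,b,c,d)` by replacing `x` with `v`, the derived family is again `F`): `G` has an
`H(X)`-minor iff `G_B = G[B] + uv` has an `H(X_A)`-minor. -/
theorem two_sep_root_in_cut
    {V W : Type*} [Fintype V] [Fintype W] [DecidableEq V]
    (H : SimpleGraph W) (hH3 : KConnected H 3)
    (G : SimpleGraph V) (hG2 : KConnected G 2)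
    (A B : Set V) (u v : V) (huv : u ≠ v)
    (hsep : IsSeparation G A B) (hAB : A ∩ B = {u, v})
    (huB : u ∈ B) (hvB : v ∈ B)
    (a b c d : V) (hab : a ≠ b) (hac : a ≠ c) (had : a ≠ d) (hbc : b ≠ c) (hbd : b ≠ d)
    (hcd : c ≠ d)
    (F : Set (Fin 4 → W)) (hF : ∀ π ∈ F, Function.Injective π)
    (hua : u = a)
    (x : V) (hx : x ∈ ({b, c, d} : Set V)) (hxA : x ∈ A \ {u, v})
    (hrest : ∀ y ∈ ({b, c, d} : Set V), y ≠ x → y ∈ B \ {u, v}) :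
    ∀ r' : Fin 4 → B,
      (∀ i, (r' i : V) = if ![a, b, c, d] i = x then v else ![a, b, c, d] i) →
      (HasRootedMinor G H ![a, b, c, d] F ↔
        HasRootedMinor
          (G.induce B ⊔ SimpleGraph.fromEdgeSet {s((⟨u, huB⟩ : B), (⟨v, hvB⟩ : B))}) H
          r' F) := by
  intro r' hr'
  subst hua
  have hxB : x ∉ B := fun hxB => hxA.2 (hAB ▸ ⟨hxA.1, hxB⟩)
  have key : ∀ j k₁ k₂ : Fin 4, 0 ≠ j → k₁ ≠ k₂ → 0 ≠ k₁ → 0 ≠ k₂ → j ≠ k₁ → j ≠ k₂ →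
      ![u, b, c, d] j = x → ![u, b, c, d] k₁ ∈ B → ![u, b, c, d] k₂ ∈ B →
      (HasRootedMinor G H ![u, b, c, d] F ↔
        HasRootedMinor
          (G.induce B ⊔ SimpleGraph.fromEdgeSet {s((⟨u, huB⟩ : B), (⟨v, hvB⟩ : B))}) H
          r' F) := by
    intro j k₁ k₂ hj hk h1 h2 hj1 hj2 hrj hr1 hr2
    have hinj : Function.Injective ![u, b, c, d] := by
      intro p q hpq
      fin_cases p <;> fin_cases q <;> simp_all
    have hr'' : ∀ l, (r' l : V) = if l = j then v else ![u, b, c, d] l := fun l => by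
      rw [hr' l]
      exact if_congr (by rw [← hrj, hinj.eq_iff]) rfl rfl
    exact ⟨HasRootedMinor.restrict hH3 hsep hAB huv hF hj hk h1 h2 hj1 hj2 rfl (hrj ▸ hxB) hr1
        hr2 hr'',
      HasRootedMinor.extend hG2 hsep hAB huv hF hj rfl (hrj ▸ hxA.1) (hrj ▸ hxB) hr''⟩
  rcases hx with rfl | rfl | rfl
  · exact key 1 2 3 (by decide) (by decide) (by decide) (by decide) (by decide) (by decide) rfl
      (hrest c (by simp) hbc.symm).1 (hrest d (by simp) hbd.symm).1
  · exact key 2 1 3 (by decide) (by decide) (by decide) (by decide) (by decide) (by decide) rfl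
      (hrest b (by simp) hbc).1 (hrest d (by simp) hcd.symm).1
  · exact key 3 1 2 (by decide) (by decide) (by decide) (by decide) (by decide) (by decide) rfl
      (hrest b (by simp) hbd).1 (hrest c (by simp) hcd).1

end Paper
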